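/- Let q : ℝ → ℂ be 1-periodic and integrable on [0,1] with Fourier coefficients q_m = 0 for all integers m ≤ 0, and let λ be a complex number. Suppose u, v : [0,1] → ℂ are continuously differentiable functions satisfying u'(x) = u'(0) + ∫₀ˣ (q(s) − λ)·u(s) ds and v'(x) = v'(0) + ∫₀ˣ (q(s) − λ)·v(s) ds for all x ∈ [0,1], with u(0) = 1, u'(0) = 0, v(0) = 0, v'(0) = 1. Then u(1) + v'(1) = 2·Σ_{k=0}^∞ (−1)^k·λ^k/(2k)!; that is, the Hill discriminant of q equals the Hill discriminant 2·cos(√λ) of the zero potential. -/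

import Mathlib

open Real Complex Set MeasureTheory

/-- The `m`-th Fourier coefficient of `q` on `[0,1]`. -/
noncomputable def fourierCoeff01 (q : ℝ → ℂ) (m : ℤ) : ℂ :=
  ∫ x in (0:ℝ)..1, q x * Complex.exp (-(2 * Real.pi * Complex.I * m) * (x : ℂ))

/-- `F` is the absolutely continuous function on `[0,1]` with integrable derivative `f`. -/
def IsPrimitive (F f : ℝ → ℂ) : Prop :=
  IntervalIntegrable f volume 0 1 ∧ ∀ x ∈ Icc (0:ℝ) 1, F x = F 0 + ∫ s in (0:ℝ)..x, f s

theorem absolutelyContinuousOnInterval_primitive {f : ℝ → ℂ} {a b : ℝ}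
    (hf : IntervalIntegrable f volume a b) (c : ℂ) :
    AbsolutelyContinuousOnInterval (fun x => c + ∫ s in a..x, f s) a b := by
  have hN := hf.norm.absolutelyContinuousOnInterval_intervalIntegral (c := a) (by simp)
  rw [absolutelyContinuousOnInterval_iff] at hN ⊢
  intro ε hε
  obtain ⟨δ, hδ, h⟩ := hN ε hε
  refine ⟨δ, hδ, fun E hE hlt => lt_of_le_of_lt (Finset.sum_le_sum fun i hi => ?_) (h E hE hlt)⟩
  have hi' := hE.1 i hi
  have hsub : ∀ {x}, x ∈ uIcc a b → IntervalIntegrable f volume a x := fun hx =>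
    hf.mono_set (uIcc_subset_uIcc_left hx)
  have h1 := hsub hi'.1
  have h2 := hsub hi'.2
  rw [dist_add_left, dist_eq_norm, dist_eq_norm,
    intervalIntegral.integral_interval_sub_left h1 h2,
    intervalIntegral.integral_interval_sub_left h1.norm h2.norm, Real.norm_eq_abs]
  exact intervalIntegral.norm_integral_le_abs_integral_norm

theorem intervalIntegrable_of_mem {f : ℝ → ℂ} (hf : IntervalIntegrable f volume 0 1) {x : ℝ}
    (hx : x ∈ Icc (0:ℝ) 1) : IntervalIntegrable f volume 0 x :=
  hf.mono_set (uIcc_subset_uIcc_left (by rwa [uIcc_of_le zero_le_one]))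

namespace IsPrimitive

variable {F G f g : ℝ → ℂ}

theorem continuousOn (h : IsPrimitive F f) : ContinuousOn F (Icc 0 1) := by
  have := (absolutelyContinuousOnInterval_primitive h.1 (F 0)).continuousOn
  rw [uIcc_of_le zero_le_one] at this
  exact this.congr h.2

theorem of_hasDerivAt (h : ∀ x, HasDerivAt F (f x) x) (hf : Continuous f) : IsPrimitive F f :=
  ⟨hf.intervalIntegrable _ _, fun x _ => by
    rw [intervalIntegral.integral_eq_sub_of_hasDerivAt (fun y _ => h y)
      (hf.intervalIntegrable _ _)]
    ring⟩

theorem congr (h : IsPrimitive F f) (hg : EqOn f g (Icc 0 1)) : IsPrimitive F g := by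
  refine ⟨h.1.congr fun x hx => hg ?_, fun x hx => ?_⟩
  · rw [uIoc_of_le zero_le_one] at hx
    exact Ioc_subset_Icc_self hx
  · rw [h.2 x hx]
    congr 1
    refine intervalIntegral.integral_congr fun y hy => hg ?_
    rw [uIcc_of_le hx.1] at hy
    exact ⟨hy.1, hy.2.trans hx.2⟩

theorem sub (hF : IsPrimitive F f) (hG : IsPrimitive G g) :
    IsPrimitive (fun x => F x - G x) (fun x => f x - g x) := by
  refine ⟨hF.1.sub hG.1, fun x hx => ?_⟩
  beta_reduce
  rw [intervalIntegral.integral_sub (intervalIntegrable_of_mem hF.1 hx)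
    (intervalIntegrable_of_mem hG.1 hx), hF.2 x hx, hG.2 x hx]
  ring

theorem add (hF : IsPrimitive F f) (hG : IsPrimitive G g) :
    IsPrimitive (fun x => F x + G x) (fun x => f x + g x) := by
  refine ⟨hF.1.add hG.1, fun x hx => ?_⟩
  beta_reduce
  rw [intervalIntegral.integral_add (intervalIntegrable_of_mem hF.1 hx)
    (intervalIntegrable_of_mem hG.1 hx), hF.2 x hx, hG.2 x hx]
  ring

theorem const_mul (hF : IsPrimitive F f) (c : ℂ) :
    IsPrimitive (fun x => c * F x) (fun x => c * f x) := by
  refine ⟨hF.1.const_mul c, fun x hx => ?_⟩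
  beta_reduce
  rw [intervalIntegral.integral_const_mul, hF.2 x hx]
  ring

theorem mul (hF : IsPrimitive F f) (hG : IsPrimitive G g) :
    IsPrimitive (fun x => F x * G x) (fun x => f x * G x + F x * g x) := by
  have hFc := hF.continuousOn
  have hGc := hG.continuousOn
  rw [← uIcc_of_le (zero_le_one (α := ℝ))] at hFc hGc
  have hint : IntervalIntegrable (fun x => f x * G x + F x * g x) volume 0 1 :=
    (hF.1.mul_continuousOn hGc).add (hG.1.continuousOn_mul hFc)
  refine ⟨hint, ?_⟩
  have hac := ((absolutelyContinuousOnInterval_primitive hF.1 (F 0)).fun_smul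
    (absolutelyContinuousOnInterval_primitive hG.1 (G 0))).fun_sub
    (absolutelyContinuousOnInterval_primitive hint 0)
  obtain ⟨C, hC⟩ := hac.const_of_ae_hasDerivAt_zero (by
    filter_upwards [hF.1.ae_hasDerivAt_integral, hG.1.ae_hasDerivAt_integral,
      hint.ae_hasDerivAt_integral] with x h1 h2 h3 hx
    have h0 : (0:ℝ) ∈ uIcc (0:ℝ) 1 := by simp
    have hx' : x ∈ Icc (0:ℝ) 1 := by rwa [uIcc_of_le zero_le_one] at hx
    have := (((h1 hx 0 h0).const_add (F 0)).mul ((h2 hx 0 h0).const_add (G 0))).sub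
      ((h3 hx 0 h0).const_add 0)
    refine HasDerivAt.congr_deriv this ?_
    rw [← hF.2 x hx', ← hG.2 x hx']
    ring)
  intro x hx
  have hx1 := hC x (by rwa [uIcc_of_le zero_le_one])
  have hx0 := hC 0 (by simp)
  simp only [smul_eq_mul, ← hF.2 x hx, ← hG.2 x hx, intervalIntegral.integral_same] at hx1 hx0
  linear_combination hx1 - hx0

theorem eq_of_eqOn_zero (hF : IsPrimitive F f) (hf : EqOn f 0 (Icc 0 1)) {x : ℝ}
    (hx : x ∈ Icc (0:ℝ) 1) : F x = F 0 := by
  simpa using (hF.congr hf).2 x hx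

theorem integral_eq (hF : IsPrimitive F f) : ∫ x in (0:ℝ)..1, f x = F 1 - F 0 := by
  rw [hF.2 1 (right_mem_Icc.2 zero_le_one)]
  ring

end IsPrimitive

theorem isPrimitive_exp (c : ℂ) :
    IsPrimitive (fun x : ℝ => Complex.exp (c * x)) (fun x : ℝ => c * Complex.exp (c * x)) :=
  .of_hasDerivAt (fun x => by
    have h : HasDerivAt (fun x : ℝ => c * (x : ℂ)) c x := by
      simpa using (Complex.ofRealCLM.hasDerivAt (x := x)).const_mul c
    simpa [mul_comm] using h.cexp) (by fun_prop)

theorem exp_two_pi_mul_int (n : ℤ) : Complex.exp (-(2 * Real.pi * Complex.I * n)) = 1 := by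
  rw [Complex.exp_neg,
    show (2 * Real.pi * Complex.I * n : ℂ) = n * (2 * Real.pi * Complex.I) by ring,
    Complex.exp_int_mul_two_pi_mul_I, inv_one]

theorem intervalIntegrable_mul_exp {f : ℝ → ℂ} (hf : IntervalIntegrable f volume 0 1) (c : ℂ) :
    IntervalIntegrable (fun x : ℝ => f x * Complex.exp (c * (x : ℂ))) volume 0 1 :=
  hf.mul_continuousOn (by fun_prop)

theorem fourierCoeff01_sub {f g : ℝ → ℂ} (hf : IntervalIntegrable f volume 0 1)
    (hg : IntervalIntegrable g volume 0 1) (n : ℤ) :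
    fourierCoeff01 (fun x => f x - g x) n = fourierCoeff01 f n - fourierCoeff01 g n := by
  simp only [fourierCoeff01, sub_mul]
  exact intervalIntegral.integral_sub (intervalIntegrable_mul_exp hf _)
    (intervalIntegrable_mul_exp hg _)

theorem fourierCoeff01_const_mul (f : ℝ → ℂ) (c : ℂ) (n : ℤ) :
    fourierCoeff01 (fun x => c * f x) n = c * fourierCoeff01 f n := by
  simp only [fourierCoeff01, mul_assoc]
  exact intervalIntegral.integral_const_mul _ _

/-- Integration by parts for Fourier coefficients of absolutely continuous periodic functions. -/
theorem fourierCoeff01_of_isPrimitive {F f : ℝ → ℂ} (h : IsPrimitive F f) (h1 : F 1 = F 0)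
    (n : ℤ) : fourierCoeff01 f n = 2 * Real.pi * Complex.I * n * fourierCoeff01 F n := by
  have hE := isPrimitive_exp (-(2 * Real.pi * Complex.I * n))
  have key := (h.mul hE).integral_eq
  have hF : IntervalIntegrable F volume 0 1 := by
    apply ContinuousOn.intervalIntegrable
    rw [uIcc_of_le zero_le_one]
    exact h.continuousOn
  rw [intervalIntegral.integral_add (intervalIntegrable_mul_exp h.1 _)
    (((intervalIntegrable_mul_exp hF _).const_mul _).congr fun x _ => mul_left_comm _ _ _)] at key
  simp only [mul_left_comm (F _)] at key
  rw [intervalIntegral.integral_const_mul] at key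
  simp only [Complex.ofReal_one, Complex.ofReal_zero, mul_one, mul_zero, Complex.exp_zero,
    exp_two_pi_mul_int, h1, sub_self] at key
  simp only [fourierCoeff01]
  linear_combination key

theorem fourierCoeff01_zero (f : ℝ → ℂ) : fourierCoeff01 f 0 = ∫ x in (0:ℝ)..1, f x := by
  simp [fourierCoeff01]

theorem fourierCoeff01_const (c : ℂ) (n : ℤ) :
    fourierCoeff01 (fun _ => c) n = if n = 0 then c else 0 := by
  split_ifs with hn
  · simp [hn, fourierCoeff01_zero]
  · have h : IsPrimitive (fun _ => c) (fun _ => 0) :=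
      .of_hasDerivAt (fun x => hasDerivAt_const x c) continuous_const
    have := fourierCoeff01_of_isPrimitive h rfl n
    simpa [fourierCoeff01_const_mul, hn, fourierCoeff01, Real.pi_ne_zero] using this

theorem eqOn_zero_of_fourierCoeff01 {D : ℝ → ℂ} (hc : ContinuousOn D (Icc 0 1)) (h01 : D 0 = D 1)
    (hD : ∀ n, fourierCoeff01 D n = 0) : EqOn D 0 (Icc 0 1) := by
  have : Fact ((0:ℝ) < 1) := ⟨zero_lt_one⟩
  let f : C(AddCircle (1:ℝ), ℂ) := ⟨AddCircle.liftIco 1 0 D,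
    AddCircle.liftIco_continuous (by simpa using h01) (by simpa using hc)⟩
  have hf : ∀ n, fourierCoeff f n = 0 := fun n => by
    have h := fourierCoeff_eq_intervalIntegral (T := 1) f n 0
    rw [h, ← hD n, fourierCoeff01, zero_add]
    simp only [div_one, one_smul]
    refine intervalIntegral.integral_congr_Ioo_of_le zero_le_one fun x hx => ?_
    have hx' : f (x : AddCircle (1:ℝ)) = D x :=
      AddCircle.liftIco_coe_apply (by simpa using Ioo_subset_Ico_self hx)
    simp only [hx', smul_eq_mul, fourier_coe_apply]
    rw [mul_comm]
    congr 2
    push_cast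
    ring
  have hz : ∀ x ∈ Ico (0:ℝ) 1, D x = 0 := fun x hx => by
    have hx' : f (x : AddCircle (1:ℝ)) = D x :=
      AddCircle.liftIco_coe_apply (by simpa using hx)
    have hs := has_pointwise_sum_fourier_series_of_summable (f := f)
      (by simp [funext hf]) x
    simp only [hf, zero_smul] at hs
    rw [← hx', hs.unique hasSum_zero]
  intro x hx
  rcases hx.2.eq_or_lt with rfl | h
  · rw [← h01, hz 0 (by simp)]
    rfl
  · exact hz x ⟨hx.1, h⟩

/-- A continuous periodic function whose Fourier coefficients are those of a primitive of `R`
is a primitive of `R`. -/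
theorem isPrimitive_of_fourierCoeff01 {F R : ℝ → ℂ} (hF : ContinuousOn F (Icc 0 1))
    (h01 : F 0 = F 1) (hR : IntervalIntegrable R volume 0 1)
    (h : ∀ n, fourierCoeff01 R n = 2 * Real.pi * Complex.I * n * fourierCoeff01 F n) :
    IsPrimitive F R := by
  set W : ℝ → ℂ := fun x => ∫ s in (0:ℝ)..x, R s with hW
  have hWR : IsPrimitive W R := ⟨hR, fun x _ => by simp [hW]⟩
  have hW0 : W 0 = 0 := by simp [hW]
  have hW1 : W 1 = 0 := by
    have := h 0
    rw [fourierCoeff01_zero] at this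
    simpa using this
  set c := fourierCoeff01 (fun x => F x - W x) 0 with hc
  have hcont : ContinuousOn (fun x => F x - W x) (Icc 0 1) := hF.sub hWR.continuousOn
  have hI : ∀ {g : ℝ → ℂ}, ContinuousOn g (Icc 0 1) → IntervalIntegrable g volume 0 1 :=
    fun hg => ContinuousOn.intervalIntegrable (by rwa [uIcc_of_le zero_le_one])
  have hD := eqOn_zero_of_fourierCoeff01 (D := fun x => (F x - W x) - c)
    (hcont.sub continuousOn_const) (by simp [h01, hW0, hW1]) (fun n => by
      rw [fourierCoeff01_sub (hI hcont) (by simp), fourierCoeff01_const]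
      split_ifs with hn
      · rw [hn, ← hc, sub_self]
      · rw [fourierCoeff01_sub (hI hF) (hI hWR.continuousOn), sub_zero]
        have h1 := h n
        rw [fourierCoeff01_of_isPrimitive hWR (hW1.trans hW0.symm)] at h1
        have : (2 * Real.pi * Complex.I * n : ℂ) ≠ 0 := by simp [hn, Real.pi_ne_zero]
        rw [mul_left_cancel₀ this h1, sub_self])
  refine ⟨hR, fun x hx => ?_⟩
  have hx := hD hx
  have h0 := hD (left_mem_Icc.2 zero_le_one)
  simp only [Pi.zero_apply, hW0] at hx h0
  change F x = F 0 + W x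
  linear_combination hx - h0

/-- Fourier coefficients of the product of an integrable function and an absolutely convergent
one-sided Fourier series. -/
theorem hasSum_fourierCoeff01_mul {q : ℝ → ℂ} (hq : IntervalIntegrable q volume 0 1) {c : ℕ → ℂ}
    (hc : Summable fun k => ‖c k‖) (n : ℤ) :
    HasSum (fun k : ℕ => c k * fourierCoeff01 q (n - k)) (fourierCoeff01
      (fun x => q x * ∑' k : ℕ, c k * Complex.exp (2 * Real.pi * Complex.I * k * x)) n) := by
  have hnorm : ∀ (m : ℤ) (x : ℝ), ‖Complex.exp (-(2 * Real.pi * Complex.I * m) * x)‖ = 1 :=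
    fun m x => by
      rw [← Complex.norm_exp_ofReal_mul_I (-(2 * Real.pi * m * x))]
      congr 2
      push_cast
      ring
  have hs : ∀ x : ℝ, Summable fun k : ℕ => c k * Complex.exp (2 * Real.pi * Complex.I * k * x) :=
    fun x => .of_norm (hc.congr fun k => by
      have := hnorm (-k) x
      push_cast at this
      rw [mul_neg, neg_neg] at this
      rw [norm_mul, this, mul_one])
  have key := intervalIntegral.hasSum_integral_of_dominated_convergence (μ := volume)
    (a := 0) (b := 1)
    (F := fun (k : ℕ) (x : ℝ) =>
      c k * (q x * Complex.exp (-(2 * Real.pi * Complex.I * (n - k : ℤ)) * (x : ℂ))))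
    (f := fun x : ℝ => q x * (∑' k : ℕ, c k * Complex.exp (2 * Real.pi * Complex.I * k * x)) *
      Complex.exp (-(2 * Real.pi * Complex.I * n) * (x : ℂ)))
    (fun k x => ‖c k‖ * ‖q x‖)
    (fun k => ((intervalIntegrable_mul_exp hq _).const_mul _).aestronglyMeasurable_restrict_uIoc)
    (fun k => .of_forall fun x _ => by rw [norm_mul, norm_mul, hnorm, mul_one])
    (.of_forall fun x _ => hc.mul_right _)
    (by simpa only [tsum_mul_right] using hq.norm.const_mul _)
    (.of_forall fun x _ => by
      have := ((hs x).hasSum.mul_left (q x)).mul_right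
        (Complex.exp (-(2 * Real.pi * Complex.I * n) * (x : ℂ)))
      refine (congrArg (HasSum · _) (funext fun k => ?_)).mp this
      have he : Complex.exp (-(2 * Real.pi * Complex.I * (n - k : ℤ)) * (x : ℂ)) =
          Complex.exp (2 * Real.pi * Complex.I * k * x) *
            Complex.exp (-(2 * Real.pi * Complex.I * n) * (x : ℂ)) := by
        rw [← Complex.exp_add]
        congr 1
        push_cast
        ring
      simp only [he]
      ring)
  simpa only [intervalIntegral.integral_const_mul, fourierCoeff01] using key

/-- The coefficients of the periodic factor of a Floquet solution, determined recursively. -/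
noncomputable def floquetCoeff (a : ℕ → ℂ) (μ : ℂ) : ℕ → ℂ
  | 0 => 1
  | n + 1 => -(∑ k : Fin (n + 1), a (n + 1 - k) * floquetCoeff a μ k) /
      (4 * Real.pi * (n + 1) * (μ + Real.pi * (n + 1)))

theorem pi_mul_le_norm_add {μ : ℂ} (hμ : 0 ≤ μ.re) (n : ℕ) :
    Real.pi * (n + 1) ≤ ‖μ + Real.pi * (n + 1)‖ := by
  refine le_trans ?_ (Complex.re_le_norm _)
  simpa using hμ

theorem floquetCoeff_recursion (a : ℕ → ℂ) {μ : ℂ} (hμ : 0 ≤ μ.re) (n : ℕ) :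
    4 * Real.pi * n * (μ + Real.pi * n) * floquetCoeff a μ n =
      -∑ k ∈ Finset.range n, a (n - k) * floquetCoeff a μ k := by
  cases n with
  | zero => simp
  | succ n =>
    have h1 : (μ + Real.pi * (n + 1) : ℂ) ≠ 0 := by
      rw [← norm_pos_iff]
      exact lt_of_lt_of_le (by positivity) (pi_mul_le_norm_add hμ n)
    have h2 : (4 * Real.pi * (n + 1) : ℂ) ≠ 0 := by
      have : (n + 1 : ℂ) ≠ 0 := by exact_mod_cast n.succ_ne_zero
      simp [Real.pi_ne_zero, this]
    rw [floquetCoeff, Finset.sum_range]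
    push_cast
    field_simp

theorem norm_floquetCoeff_succ_le {a : ℕ → ℂ} {K : ℝ} (ha : ∀ n, ‖a n‖ ≤ K) {μ : ℂ}
    (hμ : 0 ≤ μ.re) (n : ℕ) : ‖floquetCoeff a μ (n + 1)‖ ≤
      (∑ k ∈ Finset.range (n + 1), ‖floquetCoeff a μ k‖) * (K / ((n + 1 : ℕ) : ℝ) ^ 2) := by
  have hS : ‖∑ k ∈ Finset.range (n + 1), a (n + 1 - k) * floquetCoeff a μ k‖ ≤
      (∑ k ∈ Finset.range (n + 1), ‖floquetCoeff a μ k‖) * K := by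
    rw [Finset.sum_mul]
    refine norm_sum_le_of_le _ fun k _ => ?_
    rw [norm_mul, mul_comm]
    gcongr
    exact ha _
  have h := congrArg norm (floquetCoeff_recursion a hμ (n + 1))
  have hlow : ((n + 1 : ℕ) : ℝ) ^ 2 ≤
      ‖(4 * Real.pi * (n + 1 : ℕ) * (μ + Real.pi * (n + 1 : ℕ)) : ℂ)‖ := by
    have h1 := pi_mul_le_norm_add hμ n
    have hpi := Real.pi_gt_three
    have hn : (0:ℝ) ≤ n := n.cast_nonneg
    rw [norm_mul, norm_mul, norm_mul, Complex.norm_natCast, Complex.norm_real, Real.norm_eq_abs,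
      abs_of_pos Real.pi_pos, Complex.norm_ofNat]
    push_cast
    have h2 : (n + 1 : ℝ) ≤ 4 * Real.pi * (n + 1) := by nlinarith
    have h3 : (n + 1 : ℝ) ≤ ‖μ + Real.pi * (n + 1)‖ := by nlinarith
    nlinarith
  rw [norm_mul, norm_neg] at h
  rw [← mul_div_assoc, le_div_iff₀ (by positivity), mul_comm]
  exact (mul_le_mul_of_nonneg_right hlow (norm_nonneg _)).trans (h.le.trans hS)

theorem summable_norm_floquetCoeff {a : ℕ → ℂ} {K : ℝ} (ha : ∀ n, ‖a n‖ ≤ K) {μ : ℂ}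
    (hμ : 0 ≤ μ.re) : Summable fun n => ‖floquetCoeff a μ n‖ := by
  have hK : 0 ≤ K := (norm_nonneg _).trans (ha 0)
  have hsum : Summable fun n : ℕ => K / (n : ℝ) ^ 2 := by
    simpa [div_eq_mul_inv] using (Real.summable_nat_pow_inv.2 one_lt_two).mul_left K
  have hS : ∀ n : ℕ, ∑ k ∈ Finset.range (n + 1), ‖floquetCoeff a μ k‖ ≤
      Real.exp (∑ k ∈ Finset.range (n + 1), K / (k : ℝ) ^ 2) := by
    intro n
    induction n with
    | zero => simp [floquetCoeff]
    | succ n ih =>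
      rw [Finset.sum_range_succ, Finset.sum_range_succ (fun k : ℕ => K / (k : ℝ) ^ 2),
        Real.exp_add]
      calc _ ≤ _ := add_le_add_right (norm_floquetCoeff_succ_le ha hμ n) _
        _ = (∑ k ∈ Finset.range (n + 1), ‖floquetCoeff a μ k‖) *
            (K / ((n + 1 : ℕ) : ℝ) ^ 2 + 1) := by ring
        _ ≤ _ := mul_le_mul ih (Real.add_one_le_exp _) (by positivity) (by positivity)
  refine summable_of_sum_range_le (c := Real.exp (∑' k : ℕ, K / (k : ℝ) ^ 2))
    (fun _ => norm_nonneg _) fun n => ?_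
  calc _ ≤ ∑ k ∈ Finset.range (n + 1), ‖floquetCoeff a μ k‖ :=
        Finset.sum_le_sum_of_subset_of_nonneg (Finset.range_mono n.le_succ)
          fun _ _ _ => norm_nonneg _
    _ ≤ _ := hS n
    _ ≤ _ := Real.exp_le_exp.2 (hsum.sum_le_tsum _ fun _ _ => by positivity)

theorem norm_fourierCoeff01_le {q : ℝ → ℂ} (n : ℤ) :
    ‖fourierCoeff01 q n‖ ≤ ∫ x in (0:ℝ)..1, ‖q x‖ := by
  refine (intervalIntegral.norm_integral_le_integral_norm zero_le_one).trans_eq ?_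
  refine intervalIntegral.integral_congr fun x _ => ?_
  have : -(2 * Real.pi * Complex.I * n) * (x : ℂ) =
      ((-(2 * Real.pi * n * x) : ℝ) : ℂ) * Complex.I := by
    push_cast
    ring
  simp only [norm_mul, this, Complex.norm_exp_ofReal_mul_I, mul_one]

/-- `y` is a Carathéodory solution of `-y'' + q y = lam y` on `[0,1]` with derivative `gy`. -/
def IsSolution (q : ℝ → ℂ) (lam : ℂ) (y gy : ℝ → ℂ) : Prop :=
  IsPrimitive y gy ∧ IsPrimitive gy (fun s => (q s - lam) * y s)

theorem IsSolution.wronskian_eq {q : ℝ → ℂ} {lam : ℂ} {y gy z gz : ℝ → ℂ}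
    (hy : IsSolution q lam y gy) (hz : IsSolution q lam z gz) {x : ℝ} (hx : x ∈ Icc (0:ℝ) 1) :
    y x * gz x - gy x * z x = y 0 * gz 0 - gy 0 * z 0 :=
  ((hy.1.mul hz.2).sub (hy.2.mul hz.1)).eq_of_eqOn_zero (fun s _ => by
    simp only [Pi.zero_apply]
    ring) hx

/-- For a potential with only positive frequencies, the equation has a nontrivial Floquet solution
with multiplier `exp (I * μ)` whenever `μ ^ 2 = lam` and `0 ≤ μ.re`. -/
theorem exists_floquet_solution {q : ℝ → ℂ} (hq : IntervalIntegrable q volume 0 1)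
    (hfour : ∀ m : ℤ, m ≤ 0 → fourierCoeff01 q m = 0) {μ : ℂ} (hμ : 0 ≤ μ.re) :
    ∃ y gy : ℝ → ℂ, IsSolution q (μ ^ 2) y gy ∧ y 1 = Complex.exp (Complex.I * μ) * y 0 ∧
      gy 1 = Complex.exp (Complex.I * μ) * gy 0 ∧ ∃ x ∈ Icc (0:ℝ) 1, y x ≠ 0 := by
  set a : ℕ → ℂ := fun n => fourierCoeff01 q n with ha
  set c := floquetCoeff a μ with hc
  have hcs : Summable fun k => ‖c k‖ :=
    summable_norm_floquetCoeff (fun n => norm_fourierCoeff01_le (n : ℤ)) hμ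
  set Φ : ℝ → ℂ := fun x => ∑' k : ℕ, c k * Complex.exp (2 * Real.pi * Complex.I * k * x) with hΦ
  have hΦc : Continuous Φ := by
    refine continuous_tsum (fun k => by fun_prop) hcs fun k x => ?_
    have : 2 * Real.pi * Complex.I * k * (x : ℂ) = ((2 * Real.pi * k * x : ℝ) : ℂ) * Complex.I := by
      push_cast
      ring
    rw [norm_mul, this, Complex.norm_exp_ofReal_mul_I, mul_one]
  have hΦ01 : Φ 0 = Φ 1 := by
    refine tsum_congr fun k => ?_
    have : 2 * Real.pi * Complex.I * k * ((1:ℝ) : ℂ) = k * (2 * Real.pi * Complex.I) := by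
      push_cast
      ring
    rw [this, Complex.exp_nat_mul_two_pi_mul_I]
    simp
  have hΦn : ∀ n : ℤ, HasSum (fun k : ℕ => c k * if n - k = 0 then 1 else 0)
      (fourierCoeff01 Φ n) := fun n => by
    simpa only [one_mul, fourierCoeff01_const] using
      hasSum_fourierCoeff01_mul (q := fun _ => 1) (by simp) hcs n
  have hΦnat : ∀ m : ℕ, fourierCoeff01 Φ m = c m := fun m => by
    refine (hΦn m).unique ?_
    convert hasSum_single m fun k hk => ?_ using 1
    · simp
    · simp [sub_eq_zero, Ne.symm hk]
  have hΦneg : ∀ n : ℤ, n < 0 → fourierCoeff01 Φ n = 0 := fun n hn => by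
    refine (hΦn n).unique ?_
    convert hasSum_zero using 2 with k
    rw [if_neg (by lia), mul_zero]
  set p : ℝ → ℂ := fun x => q x * Φ x with hp
  have hpi : IntervalIntegrable p volume 0 1 := hq.mul_continuousOn hΦc.continuousOn
  have hpn : ∀ n : ℤ, fourierCoeff01 p n =
      -(4 * Real.pi * n * (μ + Real.pi * n)) * fourierCoeff01 Φ n := fun n => by
    have hs := hasSum_fourierCoeff01_mul hq hcs n
    refine hs.unique ?_
    rcases lt_or_ge n 0 with hn | hn
    · rw [hΦneg n hn, mul_zero]
      convert hasSum_zero using 2 with k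
      rw [hfour _ (by lia), mul_zero]
    · lift n to ℕ using hn
      rw [hΦnat, neg_mul]
      have hrec := floquetCoeff_recursion a hμ n
      push_cast
      rw [hrec, neg_neg]
      have : ∀ k ∈ Finset.range n, a (n - k) * floquetCoeff a μ k =
          c k * fourierCoeff01 q ((n : ℤ) - k) := fun k hk => by
        simp only [hc, ha, Nat.cast_sub (Finset.mem_range.1 hk).le, mul_comm]
      rw [Finset.sum_congr rfl this]
      refine hasSum_sum_of_ne_finset_zero fun k hk => ?_
      rw [hfour _ (by simp at hk; lia), mul_zero]
  set P : ℝ → ℂ := fun x => ∫ s in (0:ℝ)..x, p s with hP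
  have hPp : IsPrimitive P p := ⟨hpi, fun x _ => by simp [hP]⟩
  have hP0 : P 0 = 0 := by simp [hP]
  have hP1 : P 1 = 0 := by
    have := hpn 0
    rw [fourierCoeff01_zero] at this
    simpa using this
  have hPn : ∀ n : ℤ, fourierCoeff01 p n = _ :=
    fourierCoeff01_of_isPrimitive hPp (hP1.trans hP0.symm)
  have hPi : IntervalIntegrable P volume 0 1 :=
    ContinuousOn.intervalIntegrable (by rw [uIcc_of_le zero_le_one]; exact hPp.continuousOn)
  have hΦi : IntervalIntegrable Φ volume 0 1 := hΦc.intervalIntegrable _ _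
  set B : ℂ := fourierCoeff01 P 0 - 2 * Complex.I * μ * fourierCoeff01 Φ 0 with hB
  set R : ℝ → ℂ := fun x => P x - 2 * Complex.I * μ * Φ x - B with hR
  have hΦR : IsPrimitive Φ R := by
    refine isPrimitive_of_fourierCoeff01 hΦc.continuousOn hΦ01
      ((hPi.sub (hΦi.const_mul _)).sub (by simp)) fun n => ?_
    rw [hR, fourierCoeff01_sub (hPi.sub (hΦi.const_mul _)) (by simp),
      fourierCoeff01_sub hPi (hΦi.const_mul _), fourierCoeff01_const_mul, fourierCoeff01_const]
    split_ifs with hn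
    · simp [hn, hB]
    · have h2 := hPn n
      rw [hpn] at h2
      have hne : (2 * Real.pi * Complex.I * n : ℂ) ≠ 0 := by simp [hn, Real.pi_ne_zero]
      apply mul_left_cancel₀ hne
      linear_combination -h2 - (4 * Real.pi * n * μ + 4 * Real.pi ^ 2 * n ^ 2) *
        fourierCoeff01 Φ n * Complex.I_sq
  have hRd : IsPrimitive R (fun x => p x - 2 * Complex.I * μ * R x) := by
    refine ((hPp.sub (hΦR.const_mul _)).sub
      (.of_hasDerivAt (fun x => hasDerivAt_const x B) continuous_const)).congr fun x _ => ?_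
    simp
  have hE := isPrimitive_exp (Complex.I * μ)
  refine ⟨fun x => Complex.exp (Complex.I * μ * x) * Φ x, _,
    ⟨hE.mul hΦR, (((hE.const_mul (Complex.I * μ)).mul hΦR).add (hE.mul hRd)).congr
      fun x _ => ?_⟩, ?_, ?_, ?_⟩
  · simp only [hp]
    linear_combination μ ^ 2 * Complex.exp (Complex.I * μ * x) * Φ x * Complex.I_sq
  · simp [hΦ01]
  · have : R 0 = R 1 := by simp [hR, hP0, hP1, hΦ01]
    simp [hΦ01, this]
    ring
  · by_contra! h
    have h1 : fourierCoeff01 Φ 0 = 0 := by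
      rw [fourierCoeff01_zero, intervalIntegral.integral_congr (g := fun _ => 0) fun x hx => ?_]
      · simp
      · rw [uIcc_of_le zero_le_one] at hx
        simpa [Complex.exp_ne_zero] using h x hx
    have h2 := hΦnat 0
    rw [Nat.cast_zero, h1, hc, floquetCoeff] at h2
    exact zero_ne_one h2

theorem hill_discriminant_of_gasymov_potential (q : ℝ → ℂ)
    (hper : ∀ x : ℝ, q (x + 1) = q x)
    (hint : IntegrableOn q (Set.Icc (0:ℝ) 1))
    (hfour : ∀ m : ℤ, m ≤ 0 → fourierCoeff01 q m = 0)
    (lam : ℂ) (u gu v gv : ℝ → ℂ)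
    (hu : ContinuousOn u (Set.Icc (0:ℝ) 1)) (hgu : ContinuousOn gu (Set.Icc (0:ℝ) 1))
    (hv : ContinuousOn v (Set.Icc (0:ℝ) 1)) (hgv : ContinuousOn gv (Set.Icc (0:ℝ) 1))
    (hu' : ∀ x ∈ Set.Icc (0:ℝ) 1, u x = u 0 + ∫ s in (0:ℝ)..x, gu s)
    (hgu' : ∀ x ∈ Set.Icc (0:ℝ) 1, gu x = gu 0 + ∫ s in (0:ℝ)..x, (q s - lam) * u s)
    (hv' : ∀ x ∈ Set.Icc (0:ℝ) 1, v x = v 0 + ∫ s in (0:ℝ)..x, gv s)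
    (hgv' : ∀ x ∈ Set.Icc (0:ℝ) 1, gv x = gv 0 + ∫ s in (0:ℝ)..x, (q s - lam) * v s)
    (hu0 : u 0 = 1) (hgu0 : gu 0 = 0) (hv0 : v 0 = 0) (hgv0 : gv 0 = 1) :
    u 1 + gv 1 = 2 * ∑' k : ℕ, (-1 : ℂ) ^ k * lam ^ k / ((2 * k).factorial : ℂ) := by
  have hI {f : ℝ → ℂ} (hf : ContinuousOn f (Icc 0 1)) : IntervalIntegrable f volume 0 1 :=
    ContinuousOn.intervalIntegrable (by rwa [uIcc_of_le zero_le_one])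
  have hq : IntervalIntegrable q volume 0 1 := by
    rwa [intervalIntegrable_iff_integrableOn_Icc_of_le zero_le_one]
  have hqI {f : ℝ → ℂ} (hf : ContinuousOn f (Icc 0 1)) :
      IntervalIntegrable (fun s => (q s - lam) * f s) volume 0 1 :=
    (hq.sub (by simp)).mul_continuousOn (by rwa [uIcc_of_le zero_le_one])
  have su : IsSolution q lam u gu := ⟨⟨hI hgu, hu'⟩, hqI hu, hgu'⟩
  have sv : IsSolution q lam v gv := ⟨⟨hI hgv, hv'⟩, hqI hv, hgv'⟩
  obtain ⟨μ, hμ, hre⟩ : ∃ μ : ℂ, μ ^ 2 = lam ∧ 0 ≤ μ.re := by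
    obtain ⟨z, hz⟩ := IsAlgClosed.exists_pow_nat_eq lam two_pos
    rcases le_total 0 z.re with h | h
    · exact ⟨z, hz, h⟩
    · exact ⟨-z, by rw [neg_sq, hz], by simpa using h⟩
  obtain ⟨y, gy, sy, hy1, hgy1, x, hx, hyx⟩ := exists_floquet_solution hq hfour hre
  rw [hμ] at sy
  have one_mem : (1:ℝ) ∈ Icc (0:ℝ) 1 := right_mem_Icc.2 zero_le_one
  have huv {t : ℝ} (ht : t ∈ Icc (0:ℝ) 1) : u t * gv t - gu t * v t = 1 := by
    simpa [hu0, hgu0, hv0, hgv0] using su.wronskian_eq sv ht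
  have hyu {t : ℝ} (ht : t ∈ Icc (0:ℝ) 1) : y t * gu t - gy t * u t = -gy 0 := by
    simpa [hu0, hgu0] using sy.wronskian_eq su ht
  have hyv {t : ℝ} (ht : t ∈ Icc (0:ℝ) 1) : y t * gv t - gy t * v t = y 0 := by
    simpa [hv0, hgv0] using sy.wronskian_eq sv ht
  set ρ := Complex.exp (Complex.I * μ) with hρ
  have e1 := hyu one_mem
  have e2 := hyv one_mem
  have e3 := huv one_mem
  rw [hy1, hgy1] at e1 e2
  have hchar : ρ ^ 2 + 1 - ρ * (u 1 + gv 1) = 0 := by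
    by_cases hα : y 0 = 0
    · by_cases hβ : gy 0 = 0
      · refine absurd ?_ hyx
        have h1 := hyu hx
        have h2 := hyv hx
        rw [hβ] at h1
        rw [hα] at h2
        linear_combination u x * h2 - v x * h1 - y x * huv hx
      · refine (mul_eq_zero.1 ?_).resolve_right hβ
        linear_combination ρ * gu 1 * e2 - (ρ * gv 1 - 1) * e1 - ρ ^ 2 * gy 0 * e3
    · refine (mul_eq_zero.1 ?_).resolve_right hα
      linear_combination -ρ * v 1 * e1 - (1 - ρ * u 1) * e2 - ρ ^ 2 * y 0 * e3
  have hcos := Complex.hasSum_cos μ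
  have hser : ∑' k : ℕ, (-1 : ℂ) ^ k * lam ^ k / ((2 * k).factorial : ℂ) = Complex.cos μ := by
    rw [← hcos.tsum_eq]
    refine tsum_congr fun k => ?_
    rw [pow_mul, hμ]
  rw [hser, Complex.two_cos, show -μ * Complex.I = -(Complex.I * μ) by ring, Complex.exp_neg,
    mul_comm μ, ← hρ]
  have hρ0 : ρ ≠ 0 := Complex.exp_ne_zero _
  field_simp
  linear_combination -hchar
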